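/- Let p1,...,p6 be natural numbers with p1 + p6 ≥ max(p2 + p5, p3 + p4). Then Ḡ(p) contains an induced r-cycle for some r ≥ 4 if and only if there exist indices i, j, l, m such that (a_i, c_l, b_j, d_m) is an induced 4-cycle in Ḡ(p) (i.e., the edges of the cycle are a_i c_l, c_l b_j, b_j d_m, d_m a_i, and a_i b_j and c_l d_m are non-edges). -/

import Mathlib

/-- The four letters labeling vertices. -/
inductive Letter : Type
  | a | b | c | d
deriving DecidableEq

/-- Whether a labeled vertex is in range for the exponent vector `(p1,…,p6)`. -/
def inRange (p1 p2 p3 p4 p5 p6 : ℕ) : Letter × ℕ → Prop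
  | (Letter.a, i) => 1 ≤ i ∧ i ≤ max p1 (max p2 p3)
  | (Letter.b, j) => 1 ≤ j ∧ j ≤ max p1 (max p4 p5)
  | (Letter.c, l) => 1 ≤ l ∧ l ≤ max p2 (max p4 p6)
  | (Letter.d, m) => 1 ≤ m ∧ m ≤ max p3 (max p5 p6)

/-- The vertex set of the graph `G(p)`. -/
def Vertex (p1 p2 p3 p4 p5 p6 : ℕ) : Type :=
  {v : Letter × ℕ // inRange p1 p2 p3 p4 p5 p6 v}

/-- Directed adjacency (one orientation of each cross-letter edge rule). -/
def dirAdj (p1 p2 p3 p4 p5 p6 : ℕ) : Letter × ℕ → Letter × ℕ → Prop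
  | (Letter.a, i), (Letter.b, j) => i + j ≤ p1 + 1
  | (Letter.a, i), (Letter.c, l) => i + l ≤ p2 + 1
  | (Letter.a, i), (Letter.d, m) => i + m ≤ p3 + 1
  | (Letter.b, j), (Letter.c, l) => j + l ≤ p4 + 1
  | (Letter.b, j), (Letter.d, m) => j + m ≤ p5 + 1
  | (Letter.c, l), (Letter.d, m) => l + m ≤ p6 + 1
  | _, _ => False

/-- The graph `G(p)` whose edge ideal is the Alexander dual of the polarization. -/
def tetraGraph (p1 p2 p3 p4 p5 p6 : ℕ) : SimpleGraph (Vertex p1 p2 p3 p4 p5 p6) where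
  Adj u v := dirAdj p1 p2 p3 p4 p5 p6 u.val v.val ∨ dirAdj p1 p2 p3 p4 p5 p6 v.val u.val
  symm := ⟨fun u v h => h.symm⟩
  loopless := by
    constructor
    rintro ⟨⟨L, i⟩, _⟩ h
    cases L <;> simp [dirAdj] at h

/-- An induced `r`-cycle in a graph: `r` distinct vertices, adjacent exactly when
cyclically consecutive. -/
def IsInducedCycle {V : Type*} (H : SimpleGraph V) (r : ℕ) (v : Fin r → V) : Prop :=
  Function.Injective v ∧
    ∀ s t : Fin r, H.Adj (v s) (v t) ↔ ((s.val + 1) % r = t.val ∨ (t.val + 1) % r = s.val)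

/-- Among two vertices with the same letter, the one with the smaller index has the
larger neighbourhood in `G(p)`. -/
theorem index_lt_of_adj_of_not_adj {p1 p2 p3 p4 p5 p6 : ℕ} {u x y : Vertex p1 p2 p3 p4 p5 p6}
    (hxy : x.val.1 = y.val.1) (hy : (tetraGraph p1 p2 p3 p4 p5 p6).Adj u y)
    (hx : ¬ (tetraGraph p1 p2 p3 p4 p5 p6).Adj u x) : y.val.2 < x.val.2 := by
  obtain ⟨⟨U, i⟩, hu⟩ := u
  obtain ⟨⟨X, j⟩, hx'⟩ := x
  obtain ⟨⟨Y, k⟩, hy'⟩ := y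
  obtain rfl : X = Y := hxy
  cases U <;> cases X <;> simp [tetraGraph, dirAdj] at hx hy ⊢ <;> omega

theorem not_adj_of_letter_eq {p1 p2 p3 p4 p5 p6 : ℕ} {x y : Vertex p1 p2 p3 p4 p5 p6}
    (hxy : x.val.1 = y.val.1) : ¬ (tetraGraph p1 p2 p3 p4 p5 p6).Adj x y := by
  obtain ⟨⟨X, j⟩, hx'⟩ := x
  obtain ⟨⟨Y, k⟩, hy'⟩ := y
  obtain rfl : X = Y := hxy
  cases X <;> simp [tetraGraph, dirAdj]

theorem IsInducedCycle.compl_adj_iff {V : Type*} {G : SimpleGraph V} {r : ℕ} {v : Fin r → V}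
    (hv : IsInducedCycle Gᶜ r v) {s t : Fin r} (hst : s ≠ t) :
    G.Adj (v s) (v t) ↔ ¬ ((s.val + 1) % r = t.val ∨ (t.val + 1) % r = s.val) := by
  rw [← hv.2 s t, SimpleGraph.compl_adj]
  have := hv.1.ne hst
  tauto

theorem isInducedCycle_four {V : Type*} {G : SimpleGraph V} {x y z w : V}
    (hxz : G.Adj x z) (hyw : G.Adj y w) (hxy : Gᶜ.Adj x y) (hyz : Gᶜ.Adj y z)
    (hzw : Gᶜ.Adj z w) (hwx : Gᶜ.Adj w x) : IsInducedCycle Gᶜ 4 ![x, y, z, w] := by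
  have h₁ := hxz.ne
  have h₂ := hyw.ne
  have h₃ := hxy.ne
  have h₄ := hyz.ne
  have h₅ := hzw.ne
  have h₆ := hwx.ne
  have hxz' : ¬ Gᶜ.Adj x z := fun h => (G.compl_adj _ _ |>.1 h).2 hxz
  have hyw' : ¬ Gᶜ.Adj y w := fun h => (G.compl_adj _ _ |>.1 h).2 hyw
  constructor
  · intro s t hst
    fin_cases s <;> fin_cases t <;> simp_all
  · generalize Gᶜ = H at *
    intro s t
    fin_cases s <;> fin_cases t <;>
      simp [hxy, hyz, hzw, hwx, hxy.symm, hyz.symm, hzw.symm, hwx.symm, hxz', hyw',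
        mt SimpleGraph.Adj.symm hxz', mt SimpleGraph.Adj.symm hyw']

/-- Two cyclically consecutive vertices of an induced cycle of length at least four have
different letters. -/
theorem IsInducedCycle.letter_ne_of_succ {p1 p2 p3 p4 p5 p6 r : ℕ}
    {v : Fin r → Vertex p1 p2 p3 p4 p5 p6} (hr : 4 ≤ r)
    (hv : IsInducedCycle (tetraGraph p1 p2 p3 p4 p5 p6)ᶜ r v) {s t : Fin r}
    (hst : (s.val + 1) % r = t.val) : (v s).val.1 ≠ (v t).val.1 := by
  intro hl
  obtain ⟨u, hu⟩ : ∃ u : Fin r, (u.val + 1) % r = s.val := by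
    rcases Nat.eq_zero_or_pos s.val with h0 | h0
    · exact ⟨⟨r - 1, by omega⟩, by simp [h0, Nat.sub_add_cancel (by omega : 1 ≤ r)]⟩
    · exact ⟨⟨s.val - 1, by omega⟩, by
        simp [Nat.sub_add_cancel h0, Nat.mod_eq_of_lt s.2]⟩
  let w : Fin r := ⟨(t.val + 1) % r, Nat.mod_lt _ (by omega)⟩
  have hw : (t.val + 1) % r = w.val := rfl
  have succ_cases : ∀ x : Fin r, (x.val + 1 < r ∧ (x.val + 1) % r = x.val + 1) ∨
      (x.val + 1 = r ∧ (x.val + 1) % r = 0) := by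
    intro x
    rcases Nat.lt_or_ge (x.val + 1) r with h | h
    · exact Or.inl ⟨h, Nat.mod_eq_of_lt h⟩
    · have : x.val + 1 = r := by omega
      exact Or.inr ⟨this, by rw [this, Nat.mod_self]⟩
  have hs' := succ_cases s
  have ht' := succ_cases t
  have hu' := succ_cases u
  have hw' := succ_cases w
  clear_value w
  have hus : u ≠ s := by rw [Ne, Fin.ext_iff]; omega
  have hut : u ≠ t := by rw [Ne, Fin.ext_iff]; omega
  have hws : w ≠ s := by rw [Ne, Fin.ext_iff]; omega
  have hwt : w ≠ t := by rw [Ne, Fin.ext_iff]; omega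
  have h₁ := index_lt_of_adj_of_not_adj hl ((hv.compl_adj_iff hut).2 (by omega))
    (mt (hv.compl_adj_iff hus).1 (by omega))
  have h₂ := index_lt_of_adj_of_not_adj hl.symm ((hv.compl_adj_iff hws).2 (by omega))
    (mt (hv.compl_adj_iff hwt).1 (by omega))
  omega

theorem IsInducedCycle.letter_injective {p1 p2 p3 p4 p5 p6 r : ℕ}
    {v : Fin r → Vertex p1 p2 p3 p4 p5 p6} (hr : 4 ≤ r)
    (hv : IsInducedCycle (tetraGraph p1 p2 p3 p4 p5 p6)ᶜ r v) :
    Function.Injective fun s => (v s).val.1 := by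
  intro s t hl
  by_contra hst
  have := mt (hv.compl_adj_iff hst).2 (not_adj_of_letter_eq hl)
  rcases not_not.1 this with h | h
  · exact hv.letter_ne_of_succ hr h hl
  · exact hv.letter_ne_of_succ hr h hl.symm

/-- The letters are in bijection with `Fin 4`. -/
def letterEquiv : Letter ≃ Fin 4 where
  toFun
    | .a => 0
    | .b => 1
    | .c => 2
    | .d => 3
  invFun := ![.a, .b, .c, .d]
  left_inv x := by cases x <;> rfl
  right_inv i := by fin_cases i <;> rfl

theorem length_le_four_of_injective {r : ℕ} {f : Fin r → Letter} (hf : Function.Injective f) :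
    r ≤ 4 := by
  simpa using Fintype.card_le_of_injective _ (letterEquiv.injective.comp hf)

theorem letter_surjective_of_injective {f : Fin 4 → Letter} (hf : Function.Injective f) :
    Function.Surjective f :=
  (letterEquiv.comp_surjective f).1
    (Finite.surjective_of_injective (letterEquiv.injective.comp hf))

/-- If the diagonals of a 4-cycle `x, y, z, w` are edges of `G(p)` and its letters are
distinct, then the letters `a` and `b` are not adjacent along the cycle. -/
theorem not_letter_a_and_letter_b {p1 p2 p3 p4 p5 p6 : ℕ}
    (h : max (p2 + p5) (p3 + p4) ≤ p1 + p6) {x y z w : Vertex p1 p2 p3 p4 p5 p6}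
    (hxz : (tetraGraph p1 p2 p3 p4 p5 p6).Adj x z) (hyw : (tetraGraph p1 p2 p3 p4 p5 p6).Adj y w)
    (hxy : (tetraGraph p1 p2 p3 p4 p5 p6)ᶜ.Adj x y) (hzw : (tetraGraph p1 p2 p3 p4 p5 p6)ᶜ.Adj z w)
    (hyz : y.val.1 ≠ z.val.1) (hxw : x.val.1 ≠ w.val.1) (hne : z.val.1 ≠ w.val.1)
    (hx : x.val.1 = Letter.a) (hy : y.val.1 = Letter.b) : False := by
  replace hxy := (SimpleGraph.compl_adj _ _ _ |>.1 hxy).2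
  replace hzw := (SimpleGraph.compl_adj _ _ _ |>.1 hzw).2
  obtain ⟨⟨X, i⟩, hX⟩ := x
  obtain ⟨⟨Y, j⟩, hY⟩ := y
  obtain ⟨⟨Z, k⟩, hZ⟩ := z
  obtain ⟨⟨W, l⟩, hW⟩ := w
  obtain rfl : X = Letter.a := hx
  obtain rfl : Y = Letter.b := hy
  cases Z <;> cases W <;> simp [tetraGraph, dirAdj] at hxz hyw hxy hzw hyz hxw hne <;> omega

theorem exists_acbd_of_letters {p1 p2 p3 p4 p5 p6 : ℕ} {x y z w : Vertex p1 p2 p3 p4 p5 p6}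
    (hxz : (tetraGraph p1 p2 p3 p4 p5 p6).Adj x z) (hyw : (tetraGraph p1 p2 p3 p4 p5 p6).Adj y w)
    (hxy : (tetraGraph p1 p2 p3 p4 p5 p6)ᶜ.Adj x y) (hyz : (tetraGraph p1 p2 p3 p4 p5 p6)ᶜ.Adj y z)
    (hzw : (tetraGraph p1 p2 p3 p4 p5 p6)ᶜ.Adj z w) (hwx : (tetraGraph p1 p2 p3 p4 p5 p6)ᶜ.Adj w x)
    (hx : x.val.1 = Letter.a) (hy : y.val.1 ≠ Letter.a) (hz : z.val.1 = Letter.b)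
    (hy' : y.val.1 ≠ Letter.b) (hw : w.val.1 ≠ Letter.a) (hw' : w.val.1 ≠ Letter.b)
    (hne : y.val.1 ≠ w.val.1) :
    ∃ v : Fin 4 → Vertex p1 p2 p3 p4 p5 p6,
      (v 0).val.1 = Letter.a ∧ (v 1).val.1 = Letter.c ∧
      (v 2).val.1 = Letter.b ∧ (v 3).val.1 = Letter.d ∧
      IsInducedCycle (tetraGraph p1 p2 p3 p4 p5 p6)ᶜ 4 v := by
  have hyw_letters : (y.val.1 = Letter.c ∧ w.val.1 = Letter.d) ∨
      (w.val.1 = Letter.c ∧ y.val.1 = Letter.d) := by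
    cases hY : y.val.1 <;> cases hW : w.val.1 <;> simp_all
  rcases hyw_letters with ⟨hc, hd⟩ | ⟨hc, hd⟩
  · exact ⟨_, hx, hc, hz, hd, isInducedCycle_four hxz hyw hxy hyz hzw hwx⟩
  · exact ⟨_, hx, hc, hz, hd,
      isInducedCycle_four hxz hyw.symm hwx.symm hzw.symm hyz.symm hxy.symm⟩

/-- A 4-cycle of the required form exists as soon as some induced 4-cycle with distinct
letters starts at the letter `a`. -/
theorem exists_acbd_of_letter_a {p1 p2 p3 p4 p5 p6 : ℕ}
    (h : max (p2 + p5) (p3 + p4) ≤ p1 + p6) {x y z w : Vertex p1 p2 p3 p4 p5 p6}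
    (hxz : (tetraGraph p1 p2 p3 p4 p5 p6).Adj x z) (hyw : (tetraGraph p1 p2 p3 p4 p5 p6).Adj y w)
    (hxy : (tetraGraph p1 p2 p3 p4 p5 p6)ᶜ.Adj x y) (hyz : (tetraGraph p1 p2 p3 p4 p5 p6)ᶜ.Adj y z)
    (hzw : (tetraGraph p1 p2 p3 p4 p5 p6)ᶜ.Adj z w) (hwx : (tetraGraph p1 p2 p3 p4 p5 p6)ᶜ.Adj w x)
    (nxy : x.val.1 ≠ y.val.1) (nxz : x.val.1 ≠ z.val.1) (nxw : x.val.1 ≠ w.val.1)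
    (nyz : y.val.1 ≠ z.val.1) (nyw : y.val.1 ≠ w.val.1) (nzw : z.val.1 ≠ w.val.1)
    (hx : x.val.1 = Letter.a) :
    ∃ v : Fin 4 → Vertex p1 p2 p3 p4 p5 p6,
      (v 0).val.1 = Letter.a ∧ (v 1).val.1 = Letter.c ∧
      (v 2).val.1 = Letter.b ∧ (v 3).val.1 = Letter.d ∧
      IsInducedCycle (tetraGraph p1 p2 p3 p4 p5 p6)ᶜ 4 v := by
  have hy := not_letter_a_and_letter_b h hxz hyw hxy hzw nyz nxw nzw hx
  have hw := not_letter_a_and_letter_b h hxz hyw.symm hwx.symm hyz.symm nzw.symm nxy nyz.symm hx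
  have hz : z.val.1 = Letter.b := by
    rw [hx] at nxy nxz nxw
    cases hY : y.val.1 <;> cases hZ : z.val.1 <;> cases hW : w.val.1 <;> simp_all
  exact exists_acbd_of_letters hxz hyw hxy hyz hzw hwx hx (hx ▸ nxy.symm) hz hy
    (hx ▸ nxw.symm) hw nyw

/-- Lemma 3.5 (graph form): assuming `p1+p6 ≥ max(p2+p5, p3+p4)`, the complement
`Ḡ(p)` has an induced `r`-cycle for some `r ≥ 4` iff it has an induced 4-cycle whose
vertices are, in cyclic order, `a_i, c_l, b_j, d_m`. -/
theorem induced_cycle_iff_acbd (p1 p2 p3 p4 p5 p6 : ℕ)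
    (h : max (p2 + p5) (p3 + p4) ≤ p1 + p6) :
    (∃ r : ℕ, 4 ≤ r ∧ ∃ v : Fin r → Vertex p1 p2 p3 p4 p5 p6,
      IsInducedCycle (tetraGraph p1 p2 p3 p4 p5 p6)ᶜ r v) ↔
    (∃ v : Fin 4 → Vertex p1 p2 p3 p4 p5 p6,
      (v 0).val.1 = Letter.a ∧ (v 1).val.1 = Letter.c ∧
      (v 2).val.1 = Letter.b ∧ (v 3).val.1 = Letter.d ∧
      IsInducedCycle (tetraGraph p1 p2 p3 p4 p5 p6)ᶜ 4 v) := by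
  constructor
  · rintro ⟨r, hr, v, hv⟩
    have hinj := hv.letter_injective hr
    obtain rfl : r = 4 := le_antisymm (length_le_four_of_injective hinj) hr
    have hsurj : Function.Surjective fun s => (v s).val.1 :=
      letter_surjective_of_injective hinj
    obtain ⟨s, hs⟩ := hsurj Letter.a
    have adj : ∀ {s t : Fin 4}, s ≠ t → ¬ ((s.val + 1) % 4 = t.val ∨ (t.val + 1) % 4 = s.val) →
        (tetraGraph p1 p2 p3 p4 p5 p6).Adj (v s) (v t) :=
      fun hne => (hv.compl_adj_iff hne).2
    refine exists_acbd_of_letter_a h (x := v s) (y := v (s + 1)) (z := v (s + 2))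
      (w := v (s + 3)) (adj ?_ ?_) (adj ?_ ?_) ((hv.2 _ _).2 ?_) ((hv.2 _ _).2 ?_)
      ((hv.2 _ _).2 ?_) ((hv.2 _ _).2 ?_) (hinj.ne ?_) (hinj.ne ?_) (hinj.ne ?_)
      (hinj.ne ?_) (hinj.ne ?_) (hinj.ne ?_) hs <;>
      clear hs <;> revert s <;> decide
  · rintro ⟨v, -, -, -, -, hv⟩
    exact ⟨4, le_rfl, v, hv⟩
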